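/- In the abstract discrete framework below, assume the discrete inf-sup condition holds with constant α > 0: for every q ∈ Q_h, α ‖q‖_Q ≤ sup over nonzero v ∈ X_h of d(v, q)/‖G v‖. Let q ∈ Q_h, φ ∈ V_h, M ≥ 0, and let r : X → ℝ be a linear functional with |r(v)| ≤ M ‖G v‖ for all v ∈ X_h. If d(v, q) = ⟪φ, v⟫ + r(v) for all v ∈ X_h, then α ‖q‖_Q ≤ (1 + C_*^{-1}) M. -/

import Mathlib

open scoped RealInnerProductSpace

/-- The dual norm `‖w‖_{S*} := sup over nonzero v ∈ S of ⟪w, v⟫ / ‖G v‖`. -/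
noncomputable def dualNorm {X Y : Type*} [NormedAddCommGroup X] [InnerProductSpace ℝ X]
    [NormedAddCommGroup Y] [InnerProductSpace ℝ Y]
    (G : X →ₗ[ℝ] Y) (S : Set X) (w : X) : ℝ :=
  ⨆ v : {v : X // v ∈ S ∧ v ≠ 0}, ⟪w, (v : X)⟫ / ‖G (v : X)‖

/-- On a finite-dimensional subspace on which `G` is injective, `⟪φ, v⟫` is bounded by a multiple
of `‖G v‖`. -/
lemma exists_inner_le_mul_norm_map {X Y : Type*}
    [NormedAddCommGroup X] [InnerProductSpace ℝ X] [NormedAddCommGroup Y] [InnerProductSpace ℝ Y]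
    (G : X →ₗ[ℝ] Y) (Xh : Submodule ℝ X) [FiniteDimensional ℝ Xh]
    (hGinj : ∀ v ∈ Xh, G v = 0 → v = 0) (φ : X) :
    ∃ K : ℝ, ∀ v ∈ Xh, ⟪φ, v⟫ ≤ K * ‖G v‖ := by
  obtain ⟨K, -, hK⟩ := (G.domRestrict Xh).exists_antilipschitzWith
    (LinearMap.ker_eq_bot'.2 fun v hv => Subtype.ext (hGinj v v.2 hv))
  refine ⟨‖φ‖ * K, fun v hv => ?_⟩
  have hv' : ‖v‖ ≤ K * ‖G v‖ := by
    simpa using hK.le_mul_dist (⟨v, hv⟩ : Xh) 0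
  calc ⟪φ, v⟫ ≤ ‖φ‖ * ‖v‖ := real_inner_le_norm φ v
    _ ≤ ‖φ‖ * (K * ‖G v‖) := by gcongr
    _ = ‖φ‖ * K * ‖G v‖ := by ring

/-- The general pressure-recovery technique: if `d(v, q) = ⟪φ, v⟫ + r(v)` on `X_h` with
`φ ∈ V_h` and `|r(v)| ≤ M ‖G v‖` on `X_h`, then the discrete inf-sup condition and the
dual-norm equivalence yield `α ‖q‖ ≤ (1 + C_*⁻¹) M`. -/
theorem pressure_recovery_technique
    {X Y Q : Type*}
    [NormedAddCommGroup X] [InnerProductSpace ℝ X]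
    [NormedAddCommGroup Y] [InnerProductSpace ℝ Y]
    [NormedAddCommGroup Q] [NormedSpace ℝ Q]
    (G : X →ₗ[ℝ] Y)
    (Xh : Submodule ℝ X) [FiniteDimensional ℝ Xh]
    (hGinj : ∀ v ∈ Xh, G v = 0 → v = 0)
    (Qh : Submodule ℝ Q)
    (d : X →ₗ[ℝ] Q →ₗ[ℝ] ℝ)
    (Cstar : ℝ) (hCstar : 0 < Cstar)
    (hdual : ∀ w ∈ {v : X | v ∈ Xh ∧ ∀ q ∈ Qh, d v q = 0},
      Cstar * dualNorm G (Xh : Set X) w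
        ≤ dualNorm G {v : X | v ∈ Xh ∧ ∀ q ∈ Qh, d v q = 0} w)
    (α : ℝ) (hα : 0 < α)
    (hinfsup : ∀ q ∈ Qh,
      α * ‖q‖ ≤ ⨆ v : {v : X // v ∈ Xh ∧ v ≠ 0}, d (v : X) q / ‖G (v : X)‖)
    (q : Q) (hq : q ∈ Qh)
    (φ : X) (hφ : φ ∈ {v : X | v ∈ Xh ∧ ∀ q ∈ Qh, d v q = 0})
    (M : ℝ) (hM : 0 ≤ M)
    (r : X →ₗ[ℝ] ℝ) (hr : ∀ v ∈ Xh, |r v| ≤ M * ‖G v‖)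
    (heq : ∀ v ∈ Xh, d v q = ⟪φ, v⟫ + r v) :
    α * ‖q‖ ≤ (1 + Cstar⁻¹) * M := by
  have hGpos {v : X} (hv : v ∈ Xh) (hv0 : v ≠ 0) : 0 < ‖G v‖ :=
    norm_pos_iff.2 fun h => hv0 (hGinj v hv h)
  have hVh : dualNorm G {v : X | v ∈ Xh ∧ ∀ q ∈ Qh, d v q = 0} φ ≤ M := by
    refine Real.iSup_le (fun ⟨v, ⟨hv, hdv⟩, hv0⟩ => ?_) hM
    rw [div_le_iff₀ (hGpos hv hv0)]
    have h := heq v hv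
    rw [hdv q hq] at h
    linarith [neg_abs_le (r v), hr v hv]
  have hXh : dualNorm G (Xh : Set X) φ ≤ Cstar⁻¹ * M :=
    (le_inv_mul_iff₀ hCstar).2 ((hdual φ hφ).trans hVh)
  obtain ⟨K, hK⟩ := exists_inner_le_mul_norm_map G Xh hGinj φ
  have hbdd : BddAbove (Set.range fun v : {v : X // v ∈ (Xh : Set X) ∧ v ≠ 0} =>
      ⟪φ, (v : X)⟫ / ‖G (v : X)‖) := by
    refine ⟨K, ?_⟩
    rintro _ ⟨⟨v, hv, hv0⟩, rfl⟩
    exact (div_le_iff₀ (hGpos hv hv0)).2 (hK v hv)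
  refine (hinfsup q hq).trans (Real.iSup_le (fun ⟨v, hv, hv0⟩ => ?_) (by positivity))
  have hφv : ⟪φ, v⟫ / ‖G v‖ ≤ Cstar⁻¹ * M := (le_ciSup hbdd ⟨v, hv, hv0⟩).trans hXh
  rw [div_le_iff₀ (hGpos hv hv0)] at hφv ⊢
  rw [heq v hv]
  linarith [le_abs_self (r v), hr v hv]
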